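/- Let K = ℚ(ζ₃) be the third cyclotomic field, R its ring of integers, ζ ∈ R a primitive third root of unity, and x ↦ x̄ the restriction to R of the nontrivial automorphism of K. Let p be a prime number with p ≡ 1 (mod 3) and let n ≥ 1 be an integer. Then there exists π ∈ R with π·π̄ = p and such that π does not divide π̄; and for any such π, writing A := R/pⁿR and letting C and D denote the images in A of the ideals πⁿR and π̄ⁿR respectively, the following hold: (i) C and D are each cyclic of order pⁿ as additive groups, C ≠ D, C ∩ D = {0}, and C + D = A; (ii) C and D are stable under multiplication by ζ, and every additive subgroup of A that is cyclic of order pⁿ and stable under multiplication by ζ is equal to C or to D. -/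

import Mathlib

set_option synthInstance.maxHeartbeats 1000000
set_option maxHeartbeats 1000000

/-- `K = ℚ(ζ₃)`, the third cyclotomic field. -/
local notation "K3" => CyclotomicField 3 ℚ
/-- `R`, the ring of integers of `K = ℚ(ζ₃)`. -/
local notation "R3" => NumberField.RingOfIntegers (CyclotomicField 3 ℚ)

/-- `R` is generated as an additive group by `1` and a primitive cube root of unity `ζ`, and `conj`
is the automorphism of `R` sending `ζ` to `ζ ^ 2`. -/
structure IsEisenstein {R : Type*} [CommRing R] (ζ : R) (conj : R ≃+* R) : Prop where
  root : ζ ^ 2 + ζ + 1 = 0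
  exists_eq (x : R) : ∃ a b : ℤ, x = a + b * ζ
  conj_root : conj ζ = ζ ^ 2

theorem exists_int_dvd_sq_add_add_one {p : ℕ} (hp : p.Prime) (hp3 : p % 3 = 1) :
    ∃ u : ℤ, (p : ℤ) ∣ u ^ 2 + u + 1 := by
  have : Fact p.Prime := ⟨hp⟩
  have hcard : 3 ∣ Fintype.card (ZMod p)ˣ := by
    rw [ZMod.card_units p]
    omega
  obtain ⟨g, hg⟩ := exists_prime_orderOf_dvd_card 3 hcard
  have hgeom := (IsPrimitiveRoot.coe_units_iff.2
    (hg ▸ IsPrimitiveRoot.orderOf g)).geom_sum_eq_zero (by norm_num)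
  refine ⟨(g : ZMod p).val, (ZMod.intCast_zmod_eq_zero_iff_dvd _ p).1 ?_⟩
  simp only [Finset.sum_range_succ, Finset.sum_range_zero] at hgeom
  push_cast
  rw [ZMod.natCast_zmod_val]
  linear_combination hgeom

namespace IsEisenstein

variable {R : Type*} [CommRing R] {ζ : R} {conj : R ≃+* R}

theorem conj_add_mul (h : IsEisenstein ζ conj) (a b : ℤ) :
    conj (a + b * ζ) = a + b * ζ ^ 2 := by
  simp [h.conj_root]

theorem mul_conj (h : IsEisenstein ζ conj) (a b : ℤ) :
    (a + b * ζ) * conj (a + b * ζ) = ((a ^ 2 - a * b + b ^ 2 : ℤ) : R) := by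
  rw [h.conj_add_mul]
  push_cast
  linear_combination (a * b + b ^ 2 * (ζ - 1) : R) * h.root

theorem conj_conj (h : IsEisenstein ζ conj) (x : R) : conj (conj x) = x := by
  obtain ⟨a, b, rfl⟩ := h.exists_eq x
  simp only [map_add, map_mul, map_intCast, h.conj_root, map_pow]
  linear_combination (b * ζ * (ζ - 1) : R) * h.root

theorem exists_mul_conj_eq (h : IsEisenstein ζ conj) (x : R) :
    ∃ m : ℕ, x * conj x = m := by
  obtain ⟨a, b, rfl⟩ := h.exists_eq x
  refine ⟨(a ^ 2 - a * b + b ^ 2).toNat, ?_⟩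
  rw [h.mul_conj, ← Int.cast_natCast,
    Int.toNat_of_nonneg (by nlinarith [sq_nonneg (a - b), sq_nonneg a, sq_nonneg b])]

theorem mul_conj_eq_conj (h : IsEisenstein ζ conj) {p : ℕ} {π : R} (hπ : π * conj π = p) :
    conj π * conj (conj π) = p := by
  rw [h.conj_conj, mul_comm, hπ]

variable [CharZero R]

theorem dvd_of_intCast_dvd_add_mul (h : IsEisenstein ζ conj) {m a b : ℤ}
    (hd : (m : R) ∣ a + b * ζ) : m ∣ a ∧ m ∣ b := by
  obtain ⟨y, hy⟩ := hd
  obtain ⟨c, d, rfl⟩ := h.exists_eq y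
  have h0 : (((a - m * c : ℤ) : R) + ((b - m * d : ℤ) : R) * ζ) = 0 := by
    push_cast
    linear_combination hy
  have h1 := h.mul_conj (a - m * c) (b - m * d)
  rw [h0, zero_mul, eq_comm, Int.cast_eq_zero] at h1
  have h2 : a - m * c = 0 := by
    nlinarith [sq_nonneg (a - m * c - 2 * (b - m * d)), sq_nonneg (a - m * c)]
  have h3 : b - m * d = 0 := by
    rw [h2] at h1
    nlinarith
  exact ⟨⟨c, by linarith⟩, ⟨d, by linarith⟩⟩

theorem dvd_of_intCast_dvd_intCast (h : IsEisenstein ζ conj) {m a : ℤ}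
    (hd : (m : R) ∣ a) : m ∣ a :=
  (h.dvd_of_intCast_dvd_add_mul (b := 0) (by simpa using hd)).1

theorem not_intCast_dvd_sub (h : IsEisenstein ζ conj) {m : ℤ} (hm : ¬ IsUnit m)
    (k : ℤ) : ¬ (m : R) ∣ ζ - k := fun hd =>
  hm <| isUnit_of_dvd_one <|
    (h.dvd_of_intCast_dvd_add_mul (a := -k) (b := 1) (by convert hd using 1; push_cast; ring)).2

section Split

variable {p : ℕ} {π : R}

theorem dvd_intCast_iff (h : IsEisenstein ζ conj) (hp : p.Prime)
    (hπ : π * conj π = p) {m : ℤ} : π ∣ (m : R) ↔ (p : ℤ) ∣ m := by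
  refine ⟨fun ⟨y, hy⟩ => ?_, fun hm => ?_⟩
  · obtain ⟨k, hk⟩ := h.exists_mul_conj_eq y
    have hm : (m : R) = conj π * conj y := by simpa using congrArg conj hy
    refine (Nat.prime_iff_prime_int.mp hp).dvd_of_dvd_pow (n := 2) ⟨k, ?_⟩
    rw [← Int.cast_inj (α := R)]
    push_cast
    rw [← hπ, ← hk, sq]
    nth_rewrite 1 [hy]
    rw [hm]
    ring
  · exact (Dvd.intro _ hπ).trans (by simpa using (Int.castRingHom R).map_dvd hm)

theorem prime (h : IsEisenstein ζ conj) (hp : p.Prime) (hπ : π * conj π = p)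
    (hd : ¬ π ∣ conj π) {u : ℤ} (hu : π ∣ ζ - u) : Prime π := by
  refine ⟨?_, fun hunit => hd hunit.dvd, fun x y hxy => ?_⟩
  · rintro rfl
    simp [eq_comm, hp.ne_zero] at hπ
  · obtain ⟨a, b, rfl⟩ := h.exists_eq x
    obtain ⟨c, d, rfl⟩ := h.exists_eq y
    have key (a b : ℤ) : π ∣ a + b * ζ ↔ (p : ℤ) ∣ a + b * u := by
      rw [← h.dvd_intCast_iff hp hπ]
      refine dvd_iff_dvd_of_dvd_sub ((hu.mul_left (b : R)).trans (dvd_of_eq ?_))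
      push_cast
      ring
    rw [key, key]
    refine (Nat.prime_iff_prime_int.mp hp).dvd_or_dvd ?_
    rw [← h.dvd_intCast_iff hp hπ]
    convert dvd_sub hxy (hu.mul_left ((a * d + b * c : R) + b * d * (ζ + u))) using 1
    push_cast
    ring

/-- Modulo `π ^ n`, the root of unity `ζ` is congruent to an integer. -/
theorem exists_pow_dvd_sub (h : IsEisenstein ζ conj) (hp : p.Prime)
    (hπ : π * conj π = p) {n : ℕ} (hd : ¬ π ∣ conj π ^ n) :
    ∃ u : ℤ, π ^ n ∣ ζ - u := by
  rcases eq_or_ne n 0 with rfl | hn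
  · exact ⟨0, by simp⟩
  obtain ⟨a, b, hab⟩ := h.exists_eq (π ^ n)
  have hb : ¬ (p : ℤ) ∣ b := by
    intro hb
    have hconj : conj π ^ n = π ^ n + b * (ζ ^ 2 - ζ) := by
      rw [← map_pow, hab, h.conj_add_mul]
      ring
    refine hd (hconj ▸ dvd_add (dvd_pow_self π hn) (Dvd.dvd.mul_right ?_ _))
    exact (h.dvd_intCast_iff hp hπ).2 hb
  obtain ⟨s, t, hst⟩ : IsCoprime (b : ℤ) ((p : ℤ) ^ n) :=
    (((Nat.prime_iff_prime_int.mp hp).coprime_iff_not_dvd.2 hb).pow_left).symm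
  refine ⟨-a * s, s + t * conj π ^ n * ζ, ?_⟩
  have hpn : (p : R) ^ n = π ^ n * conj π ^ n := by rw [← hπ, mul_pow]
  have hst' : (s * b + t * p ^ n : R) = 1 := by exact_mod_cast congrArg (Int.cast : ℤ → R) hst
  push_cast
  linear_combination (-ζ) * hst' - (s : R) * hab + t * ζ * hpn

theorem isCoprime_conj (h : IsEisenstein ζ conj) (hp : p.Prime)
    (hπ : π * conj π = p) (hd : ¬ π ∣ conj π) : IsCoprime π (conj π) := by
  obtain ⟨u, hu⟩ := h.exists_pow_dvd_sub hp hπ (n := 1) (by simpa using hd)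
  rw [pow_one] at hu
  obtain ⟨a, b, hab⟩ := h.exists_eq (conj π)
  obtain ⟨y, hy⟩ : π ∣ conj π - (a + b * u : ℤ) := by
    convert hu.mul_left (b : R) using 1
    rw [hab]
    push_cast
    ring
  have hm : ¬ (p : ℤ) ∣ a + b * u := by
    rw [← h.dvd_intCast_iff hp hπ]
    intro hm
    exact hd ((dvd_iff_dvd_of_dvd_sub ⟨y, hy⟩).2 hm)
  obtain ⟨s, t, hst⟩ := (Nat.prime_iff_prime_int.mp hp).coprime_iff_not_dvd.2 hm
  have hst' : (s * p + t * (a + b * u : ℤ) : R) = 1 := by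
    exact_mod_cast congrArg (Int.cast : ℤ → R) hst
  refine ⟨s * conj π - t * y, t, ?_⟩
  linear_combination hst' + (s : R) * hπ + (t : R) * hy

theorem not_dvd_conj_pow (h : IsEisenstein ζ conj) (hp : p.Prime)
    (hπ : π * conj π = p) (hd : ¬ π ∣ conj π) (n : ℕ) : ¬ π ∣ conj π ^ n := fun hn =>
  hd (((h.isCoprime_conj hp hπ hd).pow_right.isUnit_of_dvd' dvd_rfl hn).dvd)

theorem pow_dvd_or_conj_pow_dvd [IsDomain R] (h : IsEisenstein ζ conj) (hp : p.Prime)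
    (hπ : π * conj π = p) (hd : ¬ π ∣ conj π) {n : ℕ} {k : ℤ} {x : R}
    (hk : (p : R) ^ n ∣ (ζ - k) * x) :
    π ^ n ∣ x ∨ conj π ^ n ∣ x := by
  have hcop := h.isCoprime_conj hp hπ hd
  obtain ⟨u, hu⟩ := h.exists_pow_dvd_sub hp hπ (n := 1) (by simpa using hd)
  obtain ⟨v, hv⟩ := h.exists_pow_dvd_sub hp (h.mul_conj_eq_conj hπ) (n := 1)
    (by simpa using (map_dvd_iff conj).not.2 hd)
  rw [pow_one] at hu hv
  have hprime := h.prime hp hπ hd hu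
  have hprime' := h.prime hp (h.mul_conj_eq_conj hπ) ((map_dvd_iff conj).not.2 hd) hv
  rw [← hπ, mul_pow] at hk
  by_cases h1 : π ∣ ζ - k
  · by_cases h2 : conj π ∣ ζ - k
    · refine absurd (hcop.mul_dvd h1 h2) ?_
      rw [hπ, ← Int.cast_natCast]
      exact h.not_intCast_dvd_sub (Nat.prime_iff_prime_int.mp hp).not_isUnit k
    · exact .inr (hprime'.pow_dvd_of_dvd_mul_left n h2 ((dvd_mul_left _ _).trans hk))
  · exact .inl (hprime.pow_dvd_of_dvd_mul_left n h1 ((dvd_mul_right _ _).trans hk))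

theorem not_dvd_conj (h : IsEisenstein ζ conj) (hp : p.Prime) (hp3 : p ≠ 3)
    (hπ : π * conj π = p) : ¬ π ∣ conj π := by
  intro hd
  have hpZ := Nat.prime_iff_prime_int.mp hp
  obtain ⟨a, b, rfl⟩ := h.exists_eq π
  have hb : (p : ℤ) ∣ b := by
    have h3 : (p : ℤ) ∣ 3 * b := by
      rw [← h.dvd_intCast_iff hp hπ]
      convert (dvd_sub hd dvd_rfl).mul_right (ζ - ζ ^ 2) using 1
      rw [h.conj_add_mul]
      push_cast
      linear_combination (b * (ζ ^ 2 - 3 * ζ + 3) : R) * h.root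
    refine (hpZ.dvd_or_dvd h3).resolve_left fun h3 => hp3 ?_
    exact (Nat.prime_dvd_prime_iff_eq hp Nat.prime_three).1 (by exact_mod_cast h3)
  rw [h.mul_conj, ← Int.cast_natCast, Int.cast_inj] at hπ
  have ha : (p : ℤ) ∣ a := by
    refine hpZ.dvd_of_dvd_pow (n := 2) ?_
    rw [show a ^ 2 = p + b * (a - b) by linarith]
    exact dvd_add dvd_rfl (hb.mul_right _)
  obtain ⟨c, rfl⟩ := ha
  obtain ⟨d, rfl⟩ := hb
  refine hpZ.not_isUnit (isUnit_of_dvd_one ⟨c ^ 2 - c * d + d ^ 2, ?_⟩)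
  refine mul_left_cancel₀ hpZ.ne_zero ?_
  linear_combination -hπ

end Split

theorem exists_mul_conj_eq_prime [IsDomain R] [IsPrincipalIdealRing R] (h : IsEisenstein ζ conj)
    {p : ℕ} (hp : p.Prime) (hp3 : p % 3 = 1) : ∃ π : R, π * conj π = p := by
  obtain ⟨u, hu⟩ := exists_int_dvd_sq_add_add_one hp hp3
  have hpZ := Nat.prime_iff_prime_int.mp hp
  have hnp : ¬ Irreducible (p : R) := by
    intro hirr
    have hdvd : (p : R) ∣ (ζ - u) * (ζ - (-1 - u : ℤ)) := by
      obtain ⟨k, hk⟩ := hu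
      have hk' : (u ^ 2 + u + 1 : R) = p * k := by exact_mod_cast congrArg (Int.cast : ℤ → R) hk
      refine ⟨-k, ?_⟩
      push_cast
      linear_combination h.root - hk'
    rw [← Int.cast_natCast] at hirr hdvd
    exact (hirr.prime.dvd_or_dvd hdvd).elim (h.not_intCast_dvd_sub hpZ.not_isUnit _)
      (h.not_intCast_dvd_sub hpZ.not_isUnit _)
  have hpu : ¬ IsUnit (p : R) := fun hunit =>
    h.not_intCast_dvd_sub hpZ.not_isUnit 0 (by simpa using hunit.dvd)
  rw [irreducible_iff, not_and_or, not_not] at hnp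
  obtain ⟨x, y, hxy, hx, hy⟩ : ∃ x y : R, p = x * y ∧ ¬ IsUnit x ∧ ¬ IsUnit y := by
    simpa [hpu] using hnp
  obtain ⟨k, hk⟩ := h.exists_mul_conj_eq x
  obtain ⟨l, hl⟩ := h.exists_mul_conj_eq y
  have hkl : k * l = p ^ 2 := by
    rw [← Nat.cast_inj (R := R)]
    push_cast
    have hc : (p : R) = conj x * conj y := by simpa using congrArg conj hxy
    rw [← hk, ← hl, sq]
    nth_rewrite 1 [hxy]
    rw [hc]
    ring
  have hk1 : k ≠ 1 := by
    rintro rfl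
    exact hx (.of_mul_eq_one _ (by simpa using hk))
  have hl1 : l ≠ 1 := by
    rintro rfl
    exact hy (.of_mul_eq_one _ (by simpa using hl))
  exact ⟨x, by rw [hk, ((hp.mul_eq_prime_sq_iff hk1 hl1).1 hkl).1]⟩

section Quotient

variable {p : ℕ} {π : R} {n : ℕ} {I : Ideal R}

theorem toAddSubgroup_map_span_pow (h : IsEisenstein ζ conj) (hp : p.Prime)
    (hπ : π * conj π = p) (hd : ¬ π ∣ conj π) (hI : I = Ideal.span {(p : R) ^ n}) :
    ((Ideal.span {π ^ n}).map (Ideal.Quotient.mk I)).toAddSubgroup =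
      AddSubgroup.zmultiples (Ideal.Quotient.mk I (π ^ n)) := by
  have hπ' := h.mul_conj_eq_conj hπ
  obtain ⟨v, y, hy⟩ := h.exists_pow_dvd_sub hp hπ'
    (h.not_dvd_conj_pow hp hπ' ((map_dvd_iff conj).not.2 hd) n)
  ext z
  rw [Submodule.mem_toAddSubgroup, Ideal.map_span, Set.image_singleton,
    Ideal.mem_span_singleton', AddSubgroup.mem_zmultiples_iff]
  constructor
  · rintro ⟨x, rfl⟩
    obtain ⟨x, rfl⟩ := Ideal.Quotient.mk_surjective x
    obtain ⟨a, b, rfl⟩ := h.exists_eq x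
    refine ⟨a + b * v, ?_⟩
    rw [← map_zsmul, ← map_mul, eq_comm, Ideal.Quotient.mk_eq_mk_iff_sub_mem, hI,
      Ideal.mem_span_singleton]
    refine ⟨b * y, ?_⟩
    rw [← hπ, mul_pow, zsmul_eq_mul]
    push_cast
    linear_combination (b * π ^ n : R) * hy
  · rintro ⟨k, rfl⟩
    exact ⟨k, by rw [zsmul_eq_mul]⟩

theorem addOrderOf_mk_pow [IsDomain R] (h : IsEisenstein ζ conj) (hp : p.Prime)
    (hπ : π * conj π = p) (hd : ¬ π ∣ conj π) (hI : I = Ideal.span {(p : R) ^ n}) :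
    addOrderOf (Ideal.Quotient.mk I (π ^ n)) = p ^ n := by
  have hπn : π ^ n ≠ 0 := pow_ne_zero _ (by rintro rfl; simp [eq_comm, hp.ne_zero] at hπ)
  have key (m : ℕ) : m • Ideal.Quotient.mk I (π ^ n) = 0 ↔ p ^ n ∣ m := by
    rw [← map_nsmul, Ideal.Quotient.eq_zero_iff_mem, hI, Ideal.mem_span_singleton, nsmul_eq_mul,
      mul_comm, ← hπ, mul_pow, mul_dvd_mul_iff_left hπn]
    constructor
    · intro hm
      have hm' : π ^ n ∣ (m : R) := by simpa [h.conj_conj] using map_dvd conj hm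
      have := (h.isCoprime_conj hp hπ hd).pow.mul_dvd hm' hm
      rw [← mul_pow, hπ] at this
      exact_mod_cast h.dvd_of_intCast_dvd_intCast (m := (p : ℤ) ^ n) (a := m) (by simpa using this)
    · intro hm
      refine (Dvd.intro_left (π ^ n) ?_).trans (Nat.cast_dvd_cast hm)
      rw [← mul_pow, hπ, Nat.cast_pow]
  exact Nat.dvd_antisymm (addOrderOf_dvd_iff_nsmul_eq_zero.2 ((key _).2 dvd_rfl))
    ((key _).1 (addOrderOf_nsmul_eq_zero _))

theorem map_span_pow_inf_eq_bot (h : IsEisenstein ζ conj) (hp : p.Prime)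
    (hπ : π * conj π = p) (hd : ¬ π ∣ conj π) (hI : I = Ideal.span {(p : R) ^ n}) :
    (Ideal.span {π ^ n}).map (Ideal.Quotient.mk I) ⊓
      (Ideal.span {conj π ^ n}).map (Ideal.Quotient.mk I) = ⊥ := by
  have hle : I ≤ Ideal.span {conj π ^ n} := by
    rw [hI, Ideal.span_singleton_le_span_singleton, ← hπ, mul_pow]
    exact dvd_mul_left _ _
  rw [eq_bot_iff]
  rintro z ⟨hz, hz'⟩
  obtain ⟨x, hx, rfl⟩ := (Ideal.mem_map_iff_of_surjective _ Ideal.Quotient.mk_surjective).1 hz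
  rw [SetLike.mem_coe, Ideal.mem_quotient_iff_mem hle, Ideal.mem_span_singleton] at hz'
  rw [Ideal.mem_span_singleton] at hx
  rw [Ideal.mem_bot, Ideal.Quotient.eq_zero_iff_mem, hI, Ideal.mem_span_singleton, ← hπ, mul_pow]
  exact (h.isCoprime_conj hp hπ hd).pow.mul_dvd hx hz'

theorem map_span_pow_sup_eq_top (h : IsEisenstein ζ conj) (hp : p.Prime)
    (hπ : π * conj π = p) (hd : ¬ π ∣ conj π) :
    (Ideal.span {π ^ n}).map (Ideal.Quotient.mk I) ⊔
      (Ideal.span {conj π ^ n}).map (Ideal.Quotient.mk I) = ⊤ := by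
  rw [← Ideal.map_sup, Ideal.isCoprime_iff_sup_eq.1
    ((Ideal.isCoprime_span_singleton_iff _ _).2 (h.isCoprime_conj hp hπ hd).pow), Ideal.map_top]

theorem le_or_le_of_isAddCyclic [IsDomain R] (h : IsEisenstein ζ conj) (hp : p.Prime)
    (hπ : π * conj π = p) (hd : ¬ π ∣ conj π) (hI : I = Ideal.span {(p : R) ^ n})
    {H : AddSubgroup (R ⧸ I)} (hH : IsAddCyclic H)
    (hζH : ∀ x ∈ H, Ideal.Quotient.mk I ζ * x ∈ H) :
    H ≤ ((Ideal.span {π ^ n}).map (Ideal.Quotient.mk I)).toAddSubgroup ∨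
      H ≤ ((Ideal.span {conj π ^ n}).map (Ideal.Quotient.mk I)).toAddSubgroup := by
  obtain ⟨g, rfl⟩ := (AddSubgroup.isAddCyclic_iff_exists_zmultiples_eq_top H).1 hH
  obtain ⟨x, rfl⟩ := Ideal.Quotient.mk_surjective g
  obtain ⟨k, hk⟩ := AddSubgroup.mem_zmultiples_iff.1 (hζH _ (AddSubgroup.mem_zmultiples _))
  rw [← map_zsmul, ← map_mul, eq_comm, Ideal.Quotient.mk_eq_mk_iff_sub_mem, hI,
    Ideal.mem_span_singleton, zsmul_eq_mul, ← sub_mul] at hk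
  simp only [AddSubgroup.zmultiples_le, Submodule.mem_toAddSubgroup]
  exact (h.pow_dvd_or_conj_pow_dvd hp hπ hd hk).imp
    (fun hx => Ideal.mem_map_of_mem _ (Ideal.mem_span_singleton.2 hx))
    (fun hx => Ideal.mem_map_of_mem _ (Ideal.mem_span_singleton.2 hx))

end Quotient

end IsEisenstein

open NumberField in
theorem isEisenstein_ringOfIntegers {K : Type*} [Field K] [NumberField K]
    [IsCyclotomicExtension {3} ℚ K] {ζ : 𝓞 K} (hζ : IsPrimitiveRoot ζ 3)
    {σ : K ≃ₐ[ℚ] K} (hσ : σ ≠ AlgEquiv.refl) {conj : 𝓞 K ≃+* 𝓞 K}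
    (hconj : ∀ x : 𝓞 K, algebraMap (𝓞 K) K (conj x) = σ (algebraMap (𝓞 K) K x)) :
    IsEisenstein ζ conj := by
  have hroot : ζ ^ 2 + ζ + 1 = 0 := by
    have := hζ.geom_sum_eq_zero (by norm_num)
    simp only [Finset.sum_range_succ, Finset.sum_range_zero] at this
    linear_combination this
  refine ⟨hroot, fun x => ?_, ?_⟩
  · have hx : x ∈ Algebra.adjoin ℤ {ζ} := by
      rw [IsCyclotomicExtension.adjoin_primitive_root_eq_top (n := 3) (A := ℤ) hζ]
      trivial
    induction hx using Algebra.adjoin_induction with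
    | mem x hx => exact ⟨0, 1, by simpa using hx⟩
    | algebraMap r => exact ⟨r, 0, by simp⟩
    | add x y _ _ hx hy =>
      obtain ⟨a, b, rfl⟩ := hx
      obtain ⟨c, d, rfl⟩ := hy
      exact ⟨a + c, b + d, by push_cast; ring⟩
    | mul x y _ _ hx hy =>
      obtain ⟨a, b, rfl⟩ := hx
      obtain ⟨c, d, rfl⟩ := hy
      refine ⟨a * c - b * d, a * d + b * c - b * d, ?_⟩
      push_cast
      linear_combination (b * d : 𝓞 K) * hroot
  · have h0 : (conj ζ - ζ) * (conj ζ - ζ ^ 2) = 0 := by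
      have := congrArg conj hroot
      simp only [map_add, map_pow, map_one, map_zero] at this
      linear_combination this + (ζ - 1 - conj ζ) * hroot
    refine sub_eq_zero.1 ((mul_eq_zero.1 h0).resolve_left fun h1 => hσ ?_)
    have hζK : IsPrimitiveRoot (algebraMap (𝓞 K) K ζ) 3 :=
      hζ.map_of_injective (FaithfulSMul.algebraMap_injective (𝓞 K) K)
    refine AlgEquiv.coe_toAlgHom_injective ((hζK.powerBasis ℚ).algHom_ext ?_)
    rw [IsPrimitiveRoot.powerBasis_gen]
    simp [← hconj, sub_eq_zero.1 h1]

/-- let `R` be the ring of integers of `K = ℚ(ζ₃)`, `ζ ∈ R` a primitive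
third root of unity, and `conj : R ≃+* R` the restriction to `R` of the nontrivial
automorphism of `K`. For a prime `p ≡ 1 (mod 3)` and `n ≥ 1`, there is `π ∈ R` with
`π·π̄ = p` and `π ∤ π̄`; and for any such `π`, in `A = R/pⁿR` the images `C`, `D` of
the ideals `πⁿR` and `π̄ⁿR` are additive subgroups that are cyclic of order `pⁿ`,
distinct, with `C ⊓ D = ⊥` and `C ⊔ D = ⊤`; they are stable under multiplication by
`ζ`, and any additive subgroup of `A` that is cyclic of order `pⁿ` and stable under
multiplication by `ζ` equals `C` or `D`. -/
theorem stmt18 (p : ℕ) (hp : p.Prime) (hp3 : p % 3 = 1) (n : ℕ) (hn : 1 ≤ n)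
    (ζ : R3) (hζ : IsPrimitiveRoot ζ 3)
    (σ : K3 ≃ₐ[ℚ] K3) (hσ : σ ≠ AlgEquiv.refl)
    (conj : R3 ≃+* R3)
    (hconj : ∀ x : R3, algebraMap R3 K3 (conj x) = σ (algebraMap R3 K3 x)) :
    (∃ π : R3, π * conj π = (p : R3) ∧ ¬ (π ∣ conj π)) ∧
    ∀ π : R3, π * conj π = (p : R3) → ¬ (π ∣ conj π) →
      ∀ I : Ideal R3, I = Ideal.span {(p : R3) ^ n} →
      ∀ C D : AddSubgroup (R3 ⧸ I),
        C = ((Ideal.span {π ^ n}).map (Ideal.Quotient.mk I)).toAddSubgroup →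
        D = ((Ideal.span {(conj π) ^ n}).map (Ideal.Quotient.mk I)).toAddSubgroup →
        -- (i)
        (IsAddCyclic C ∧ Nat.card C = p ^ n ∧
         IsAddCyclic D ∧ Nat.card D = p ^ n ∧
         C ≠ D ∧ C ⊓ D = ⊥ ∧ C ⊔ D = ⊤) ∧
        -- (ii)
        ((∀ x ∈ C, Ideal.Quotient.mk I ζ * x ∈ C) ∧
         (∀ x ∈ D, Ideal.Quotient.mk I ζ * x ∈ D) ∧
         (∀ H : AddSubgroup (R3 ⧸ I), IsAddCyclic H → Nat.card H = p ^ n →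
            (∀ x ∈ H, Ideal.Quotient.mk I ζ * x ∈ H) →
            H = C ∨ H = D)) := by
  have : IsCyclotomicExtension {3} ℚ K3 := CyclotomicField.isCyclotomicExtension 3 ℚ
  have h := isEisenstein_ringOfIntegers hζ hσ hconj
  have : IsPrincipalIdealRing R3 := IsCyclotomicExtension.Rat.three_pid K3
  refine ⟨?_, ?_⟩
  · obtain ⟨π, hπ⟩ := h.exists_mul_conj_eq_prime hp hp3
    exact ⟨π, hπ, h.not_dvd_conj hp (by rintro rfl; simp at hp3) hπ⟩
  intro π hπ hd I hI C D hC hD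
  have hπ' := h.mul_conj_eq_conj hπ
  have hd' : ¬ conj π ∣ conj (conj π) := (map_dvd_iff conj).not.2 hd
  have hC' := hC.trans (h.toAddSubgroup_map_span_pow hp hπ hd hI)
  have hD' := hD.trans (h.toAddSubgroup_map_span_pow hp hπ' hd' hI)
  have hCcard : Nat.card C = p ^ n := by
    rw [hC', Nat.card_zmultiples, h.addOrderOf_mk_pow hp hπ hd hI]
  have hDcard : Nat.card D = p ^ n := by
    rw [hD', Nat.card_zmultiples, h.addOrderOf_mk_pow hp hπ' hd' hI]
  have hinf : C ⊓ D = ⊥ := by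
    rw [hC, hD]
    exact congrArg Submodule.toAddSubgroup (h.map_span_pow_inf_eq_bot hp hπ hd hI)
  have hsup : C ⊔ D = ⊤ := by
    rw [hC, hD, ← Submodule.sup_toAddSubgroup, h.map_span_pow_sup_eq_top hp hπ hd,
      Submodule.top_toAddSubgroup]
  have hpn : p ^ n ≠ 0 := pow_ne_zero n hp.ne_zero
  have : Finite C := Nat.finite_of_card_ne_zero (hCcard ▸ hpn)
  have : Finite D := Nat.finite_of_card_ne_zero (hDcard ▸ hpn)
  refine ⟨⟨hC' ▸ inferInstance, hCcard, hD' ▸ inferInstance, hDcard, ?_, hinf, hsup⟩, ?_, ?_, ?_⟩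
  · rintro rfl
    rw [inf_idem] at hinf
    rw [hinf, AddSubgroup.card_bot] at hCcard
    exact (Nat.one_lt_pow (by omega) hp.one_lt).ne hCcard
  · subst hC
    exact fun x hx => Ideal.mul_mem_left _ _ hx
  · subst hD
    exact fun x hx => Ideal.mul_mem_left _ _ hx
  · intro H hH hHcard hζH
    have hle := h.le_or_le_of_isAddCyclic hp hπ hd hI hH hζH
    rw [← hC, ← hD] at hle
    exact hle.imp
      (fun hle => AddSubgroup.eq_of_le_of_card_ge hle (hCcard.trans hHcard.symm).le)
      (fun hle => AddSubgroup.eq_of_le_of_card_ge hle (hDcard.trans hHcard.symm).le)
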